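/- Let 1 < q < ∞ and suppose α/n = β/m and (α+ρβ)/(n+ρm) = 1 − 1/q. Let Q_o = {(x,y) ∈ ℝ^n × ℝ^m : |x_i| ≤ 1 for i = 1,…,n and |y_j| ≤ 1 for j = 1,…,m}, let a(x,y) = sgn(x_1)·χ_{Q_o}(x,y) (an H^1-atom up to normalization), and let U = {x ∈ ℝ^n : 2 ≤ x_i ≤ 4 for i = 1,…,n}. Then ∬_{U×ℝ^m} |I a(x,y)|^q dx dy = ∞; in particular I does not map the atom a into L^q(ℝ^{n+m}). -/

import Mathlib

open MeasureTheory

/-- The flag kernel `Ω(x,y) = |x|^(α-n) (|x|^ρ + |y|)^(β-m)` on `ℝ^n × ℝ^m`. -/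
noncomputable def flagKernel (n m : ℕ) (α β ρ : ℝ)
    (x : EuclideanSpace ℝ (Fin n)) (y : EuclideanSpace ℝ (Fin m)) : ℝ :=
  ‖x‖ ^ (α - (n : ℝ)) * (‖x‖ ^ ρ + ‖y‖) ^ (β - (m : ℝ))

/-- The fractional integral operator `I f(x,y) = ∬ f(u,v) Ω(x-u, y-v) du dv`. -/
noncomputable def flagOp (n m : ℕ) (α β ρ : ℝ)
    (f : EuclideanSpace ℝ (Fin n) × EuclideanSpace ℝ (Fin m) → ℝ)
    (z : EuclideanSpace ℝ (Fin n) × EuclideanSpace ℝ (Fin m)) : ℝ :=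
  ∫ w : EuclideanSpace ℝ (Fin n) × EuclideanSpace ℝ (Fin m),
    f w * flagKernel n m α β ρ (z.1 - w.1) (z.2 - w.2)

open Set

/-- The reflection of `ℝ^ι` that changes the sign of the `i`-th coordinate. -/
noncomputable def reflectCoord {ι : Type*} [Fintype ι] [DecidableEq ι] (i : ι) :
    EuclideanSpace ℝ ι ≃ₗᵢ[ℝ] EuclideanSpace ℝ ι :=
  LinearIsometryEquiv.piLpCongrRight 2 fun j =>
    if j = i then LinearIsometryEquiv.neg ℝ else LinearIsometryEquiv.refl ℝ ℝ

section reflectCoord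

variable {ι : Type*} [Fintype ι] [DecidableEq ι] (i : ι)

theorem reflectCoord_apply (u : EuclideanSpace ℝ ι) (j : ι) :
    reflectCoord i u j = if j = i then -u j else u j := by
  rw [reflectCoord, LinearIsometryEquiv.piLpCongrRight_apply]
  by_cases h : j = i <;> simp [h]

theorem abs_reflectCoord_apply (u : EuclideanSpace ℝ ι) (j : ι) :
    |reflectCoord i u j| = |u j| := by
  rw [reflectCoord_apply]
  split_ifs <;> simp

theorem norm_sub_reflectCoord_sq (x u : EuclideanSpace ℝ ι) :
    ‖x - reflectCoord i u‖ ^ 2 = ‖x - u‖ ^ 2 + 4 * x i * u i := by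
  rw [EuclideanSpace.real_norm_sq_eq, EuclideanSpace.real_norm_sq_eq,
    ← Finset.add_sum_erase _ _ (Finset.mem_univ i),
    ← Finset.add_sum_erase Finset.univ (fun j => (x - u) j ^ 2) (Finset.mem_univ i)]
  have : ∑ j ∈ Finset.univ.erase i, (x - reflectCoord i u) j ^ 2
      = ∑ j ∈ Finset.univ.erase i, (x - u) j ^ 2 :=
    Finset.sum_congr rfl fun j hj => by
      simp [reflectCoord_apply, Finset.ne_of_mem_erase hj]
  rw [this]
  simp [reflectCoord_apply]
  ring

variable {i} in
theorem norm_sub_le_norm_sub_reflectCoord {x u : EuclideanSpace ℝ ι}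
    (hx : 0 ≤ x i) (hu : 0 ≤ u i) : ‖x - u‖ ≤ ‖x - reflectCoord i u‖ := by
  refine (sq_le_sq₀ (norm_nonneg _) (norm_nonneg _)).1 ?_
  rw [norm_sub_reflectCoord_sq]
  nlinarith [mul_nonneg hx hu]

variable {i} in
theorem norm_sub_reflectCoord_le_norm_sub {x u : EuclideanSpace ℝ ι}
    (hx : 0 ≤ x i) (hu : u i ≤ 0) : ‖x - reflectCoord i u‖ ≤ ‖x - u‖ := by
  refine (sq_le_sq₀ (norm_nonneg _) (norm_nonneg _)).1 ?_
  rw [norm_sub_reflectCoord_sq]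
  nlinarith [mul_nonneg hx (neg_nonneg.2 hu)]

end reflectCoord

theorem EuclideanSpace.norm_le_mul_card {k : ℕ} {B : ℝ} (hB : 0 ≤ B)
    {v : EuclideanSpace ℝ (Fin k)} (hv : ∀ i, |v i| ≤ B) : ‖v‖ ≤ B * k := by
  refine abs_le_of_sq_le_sq' ?_ (by positivity) |>.2
  rw [EuclideanSpace.real_norm_sq_eq]
  calc ∑ i, v i ^ 2 ≤ ∑ _i : Fin k, B ^ 2 :=
        Finset.sum_le_sum fun i _ => sq_le_sq' (abs_le.1 (hv i)).1 (abs_le.1 (hv i)).2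
    _ = B ^ 2 * k := by simp [mul_comm]
    _ ≤ (B * k) ^ 2 := by
        rw [mul_pow]
        gcongr
        exact_mod_cast Nat.le_self_pow two_ne_zero k

/-- Negative powers of two radii whose squares differ by at least `4` are uniformly separated
on bounded sets. -/
theorem exists_pos_le_rpow_sub_rpow {a C : ℝ} (ha : a < 0) (hC : 0 < C) :
    ∃ c > 0, ∀ r R : ℝ, 0 < r → 0 ≤ R → R ≤ C → r ^ 2 + 4 ≤ R ^ 2 → c ≤ r ^ a - R ^ a := by
  set s := √(1 + 4 / C ^ 2) with hs
  have hs2 : s ^ 2 = 1 + 4 / C ^ 2 := Real.sq_sqrt (by positivity)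
  have hs1 : 1 < s := by
    rw [hs, Real.lt_sqrt zero_le_one]
    have : 0 < 4 / C ^ 2 := by positivity
    linarith
  have hsa : s ^ a < 1 := Real.rpow_lt_one_of_one_lt_of_neg hs1 ha
  refine ⟨C ^ a * (1 - s ^ a), mul_pos (by positivity) (by linarith), ?_⟩
  intro r R hr hR hRC hrR
  have hrC : r ≤ C := by nlinarith
  have hsr : r * s ≤ R := by
    refine abs_le_of_sq_le_sq' ?_ hR |>.2
    have : r ^ 2 * (4 / C ^ 2) ≤ 4 := by
      rw [← mul_div_assoc, div_le_iff₀ (by positivity)]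
      nlinarith
    rw [mul_pow, hs2]
    linarith
  have h1 : R ^ a ≤ r ^ a * s ^ a := by
    rw [← Real.mul_rpow hr.le (by linarith)]
    exact Real.rpow_le_rpow_of_nonpos (by positivity) hsr ha.le
  have h2 : C ^ a ≤ r ^ a := Real.rpow_le_rpow_of_nonpos hr hrC ha.le
  nlinarith

section flagKernel

variable {n m : ℕ} {α β ρ : ℝ}

theorem flagKernel_nonneg (x : EuclideanSpace ℝ (Fin n)) (y : EuclideanSpace ℝ (Fin m)) :
    0 ≤ flagKernel n m α β ρ x y := by
  unfold flagKernel
  positivity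

theorem flagKernel_le_one (hα : α ≤ n) (hβ : β ≤ m) (hρ : 0 ≤ ρ)
    {x : EuclideanSpace ℝ (Fin n)} (y : EuclideanSpace ℝ (Fin m)) (hx : 1 ≤ ‖x‖) :
    flagKernel n m α β ρ x y ≤ 1 := by
  refine mul_le_one₀ (Real.rpow_le_one_of_one_le_of_nonpos hx (by linarith)) (by positivity)
    (Real.rpow_le_one_of_one_le_of_nonpos ?_ (by linarith))
  have := Real.one_le_rpow hx hρ
  have := norm_nonneg y
  linarith

theorem mul_le_flagKernel_sub (hβ : β ≤ m) (hρ : 0 ≤ ρ)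
    {x x' : EuclideanSpace ℝ (Fin n)} (y : EuclideanSpace ℝ (Fin m))
    (hx : 0 < ‖x‖) (hxx' : ‖x‖ ≤ ‖x'‖) :
    (‖x‖ ^ (α - n) - ‖x'‖ ^ (α - n)) * (‖x'‖ ^ ρ + ‖y‖) ^ (β - m)
      ≤ flagKernel n m α β ρ x y - flagKernel n m α β ρ x' y := by
  have h : (‖x'‖ ^ ρ + ‖y‖) ^ (β - m) ≤ (‖x‖ ^ ρ + ‖y‖) ^ (β - m) :=
    Real.rpow_le_rpow_of_nonpos (by positivity) (by gcongr) (by linarith)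
  unfold flagKernel
  rw [sub_mul]
  gcongr

theorem flagKernel_le_flagKernel (hα : α ≤ n) (hβ : β ≤ m) (hρ : 0 ≤ ρ)
    {x x' : EuclideanSpace ℝ (Fin n)} (y : EuclideanSpace ℝ (Fin m))
    (hx : 0 < ‖x‖) (hxx' : ‖x‖ ≤ ‖x'‖) :
    flagKernel n m α β ρ x' y ≤ flagKernel n m α β ρ x y := by
  have h : ‖x'‖ ^ (α - n) ≤ ‖x‖ ^ (α - n) :=
    Real.rpow_le_rpow_of_nonpos hx hxx' (by linarith)
  have := mul_le_flagKernel_sub (α := α) hβ hρ y hx hxx'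
  have : 0 ≤ (‖x‖ ^ (α - n) - ‖x'‖ ^ (α - n)) * (‖x'‖ ^ ρ + ‖y‖) ^ (β - m) :=
    mul_nonneg (by linarith) (by positivity)
  linarith

end flagKernel

/-- `(K + |y|)^(-m)` has infinite integral over `ℝ^m`. -/
theorem lintegral_const_add_norm_rpow_eq_top {m : ℕ} (hm : 0 < m) {K : ℝ} (hK : 0 < K) :
    ∫⁻ y : EuclideanSpace ℝ (Fin m), ENNReal.ofReal ((K + ‖y‖) ^ (-(m : ℝ))) = ⊤ := by
  have : Nonempty (Fin m) := ⟨⟨0, hm⟩⟩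
  by_contra h
  have hint : Integrable (fun y : EuclideanSpace ℝ (Fin m) => (K + ‖y‖) ^ (-(m : ℝ))) := by
    refine ⟨Measurable.aestronglyMeasurable (by fun_prop), ?_⟩
    rw [hasFiniteIntegral_iff_ofReal (.of_forall fun y => by positivity)]
    exact lt_top_iff_ne_top.2 h
  rw [integrable_fun_norm_addHaar volume (f := fun r : ℝ => (K + r) ^ (-(m : ℝ)))] at hint
  replace hint := (hint.mono_set (Ioi_subset_Ioi hK.le)).const_mul ((2 : ℝ) ^ (m : ℝ))
  refine not_integrableOn_Ioi_inv (a := K) (hint.mono' (by fun_prop) ?_)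
  refine (ae_restrict_iff' measurableSet_Ioi).2 (.of_forall fun r (hr : K < r) => ?_)
  have hr0 : 0 < r := hK.trans hr
  have h1 : (2 * r) ^ (-(m : ℝ)) ≤ (K + r) ^ (-(m : ℝ)) :=
    Real.rpow_le_rpow_of_nonpos (by linarith) (by linarith) (by simp)
  rw [Real.norm_of_nonneg (by positivity), finrank_euclideanSpace_fin, smul_eq_mul]
  calc r⁻¹ = 2 ^ (m : ℝ) * (r ^ (m - 1) * (2 * r) ^ (-(m : ℝ))) := by
        obtain ⟨k, rfl⟩ := Nat.exists_eq_succ_of_ne_zero hm.ne'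
        rw [Real.rpow_neg (by positivity), Real.rpow_natCast, Real.rpow_natCast]
        simp only [Nat.succ_eq_add_one, Nat.add_sub_cancel]
        rw [mul_pow]
        field_simp
        ring
    _ ≤ _ := by gcongr

/-- The cube `Q_o`. -/
def unitCube (n m : ℕ) : Set (EuclideanSpace ℝ (Fin n) × EuclideanSpace ℝ (Fin m)) :=
  {w | (∀ i, |w.1 i| ≤ 1) ∧ (∀ j, |w.2 j| ≤ 1)}

theorem measurableSet_unitCube (n m : ℕ) : MeasurableSet (unitCube n m) := by
  unfold unitCube
  measurability

theorem volume_unitCube_lt_top (n m : ℕ) : volume (unitCube n m) < ⊤ := by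
  have : unitCube n m ⊆ Metric.closedBall 0 (1 * n : ℝ) ×ˢ Metric.closedBall 0 (1 * m : ℝ) := by
    intro w hw
    simp only [mem_prod, mem_closedBall_zero_iff]
    exact ⟨EuclideanSpace.norm_le_mul_card zero_le_one hw.1,
      EuclideanSpace.norm_le_mul_card zero_le_one hw.2⟩
  exact (measure_mono this).trans_lt
    ((isCompact_closedBall _ _).prod (isCompact_closedBall _ _)).measure_lt_top

theorem measure_unitCube_inter_pos {n m : ℕ} (i : Fin n) :
    0 < volume (unitCube n m ∩ {w | 1 / 2 ≤ w.1 i}) := by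
  let V : Set (EuclideanSpace ℝ (Fin n) × EuclideanSpace ℝ (Fin m)) :=
    ((⋂ j, {w | |w.1 j| < 1}) ∩ ⋂ j, {w | |w.2 j| < 1}) ∩ {w | 1 / 2 < w.1 i}
  have hV : IsOpen V :=
    ((isOpen_iInter_of_finite fun j => isOpen_lt (by fun_prop) (by fun_prop)).inter
      (isOpen_iInter_of_finite fun j => isOpen_lt (by fun_prop) (by fun_prop))).inter
      (isOpen_lt (by fun_prop) (by fun_prop))
  have hne : V.Nonempty := by
    refine ⟨(WithLp.toLp 2 fun _ => 3 / 4, 0), ⟨mem_iInter.2 fun j => ?_, mem_iInter.2 fun j => ?_⟩,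
      ?_⟩ <;> norm_num [abs_of_pos]
  refine (hV.measure_pos volume hne).trans_le (measure_mono fun w hw => ?_)
  exact ⟨⟨fun j => (mem_iInter.1 hw.1.1 j : |w.1 j| < 1).le,
    fun j => (mem_iInter.1 hw.1.2 j : |w.2 j| < 1).le⟩, le_of_lt (show 1 / 2 < w.1 i from hw.2)⟩

/-- The box `U`. -/
def shiftedCube (n : ℕ) : Set (EuclideanSpace ℝ (Fin n)) := {x | ∀ i, 2 ≤ x i ∧ x i ≤ 4}

theorem measurableSet_shiftedCube (n : ℕ) : MeasurableSet (shiftedCube n) := by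
  unfold shiftedCube
  measurability

theorem measure_shiftedCube_pos (n : ℕ) : 0 < volume (shiftedCube n) := by
  let V : Set (EuclideanSpace ℝ (Fin n)) := ⋂ i, {x | 2 < x i} ∩ {x | x i < 4}
  have hV : IsOpen V := isOpen_iInter_of_finite fun i =>
    (isOpen_lt (by fun_prop) (by fun_prop)).inter (isOpen_lt (by fun_prop) (by fun_prop))
  have hne : V.Nonempty := ⟨WithLp.toLp 2 fun _ => 3, by simp [V]; norm_num⟩
  refine (hV.measure_pos volume hne).trans_le (measure_mono fun x hx i => ?_)
  have := mem_iInter.1 hx i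
  exact ⟨this.1.le, this.2.le⟩

/-- The atom `sgn(x_i) χ_{Q_o}`. -/
noncomputable def signAtom (n m : ℕ) (i : Fin n) :
    EuclideanSpace ℝ (Fin n) × EuclideanSpace ℝ (Fin m) → ℝ :=
  (unitCube n m).indicator fun w => Real.sign (w.1 i)

theorem Real.measurable_sign : Measurable Real.sign := by
  unfold Real.sign
  exact Measurable.ite measurableSet_Iio measurable_const
    (Measurable.ite measurableSet_Ioi measurable_const measurable_const)

section signAtom

variable {n m : ℕ} {α β ρ : ℝ} {i : Fin n}
  {z w : EuclideanSpace ℝ (Fin n) × EuclideanSpace ℝ (Fin m)}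

theorem measurable_signAtom (i : Fin n) : Measurable (signAtom n m i) :=
  (Real.measurable_sign.comp (by fun_prop)).indicator (measurableSet_unitCube n m)

theorem one_le_norm_sub (i : Fin n) (hz : z.1 ∈ shiftedCube n) (hw : w ∈ unitCube n m) :
    1 ≤ ‖z.1 - w.1‖ := by
  refine le_trans ?_ (PiLp.norm_apply_le (z.1 - w.1) i)
  rw [Real.norm_eq_abs, PiLp.sub_apply]
  have := (abs_le.1 (hw.1 i)).2
  have := (hz i).1
  exact le_trans (by linarith) (le_abs_self _)

theorem norm_sub_le_of_mem (hz : z.1 ∈ shiftedCube n) (hw : w ∈ unitCube n m) :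
    ‖z.1 - w.1‖ ≤ 5 * n := by
  refine EuclideanSpace.norm_le_mul_card (by norm_num) fun j => ?_
  have := abs_le.1 (hw.1 j)
  have := hz j
  rw [PiLp.sub_apply, abs_le]
  constructor <;> linarith

theorem integrable_signAtom_mul_flagKernel (hα : α ≤ n) (hβ : β ≤ m) (hρ : 0 ≤ ρ)
    (hz : z.1 ∈ shiftedCube n) :
    Integrable fun w => signAtom n m i w * flagKernel n m α β ρ (z.1 - w.1) (z.2 - w.2) := by
  have hdom : Integrable ((unitCube n m).indicator fun _ => (1 : ℝ)) :=
    (integrable_indicator_iff (measurableSet_unitCube n m)).2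
      (integrableOn_const (volume_unitCube_lt_top n m).ne)
  have hk : Measurable fun w : EuclideanSpace ℝ (Fin n) × EuclideanSpace ℝ (Fin m) =>
      flagKernel n m α β ρ (z.1 - w.1) (z.2 - w.2) := by
    unfold flagKernel
    fun_prop
  refine hdom.mono' ((measurable_signAtom i).mul hk).aestronglyMeasurable (.of_forall fun w => ?_)
  by_cases hw : w ∈ unitCube n m
  · rw [signAtom, indicator_of_mem hw, indicator_of_mem hw, norm_mul, Real.norm_eq_abs,
      Real.norm_of_nonneg (flagKernel_nonneg _ _)]
    have hs : |Real.sign (w.1 i)| ≤ 1 := by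
      rcases Real.sign_apply_eq (w.1 i) with h | h | h <;> simp [h]
    exact mul_le_one₀ hs (flagKernel_nonneg _ _)
      (flagKernel_le_one hα hβ hρ _ (one_le_norm_sub i hz hw))
  · simp [signAtom, hw]

/-- Reflection of the first factor in the `i`-th coordinate. -/
noncomputable def reflectFst (m : ℕ) (i : Fin n)
    (w : EuclideanSpace ℝ (Fin n) × EuclideanSpace ℝ (Fin m)) :
    EuclideanSpace ℝ (Fin n) × EuclideanSpace ℝ (Fin m) :=
  (reflectCoord i w.1, w.2)

theorem measurePreserving_reflectFst (i : Fin n) :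
    MeasurePreserving (reflectFst m i) :=
  (reflectCoord i).measurePreserving.prod (MeasurePreserving.id volume)

theorem measurableEmbedding_reflectFst (i : Fin n) : MeasurableEmbedding (reflectFst m i) :=
  ((reflectCoord i).toHomeomorph.prodCongr
    (Homeomorph.refl (EuclideanSpace ℝ (Fin m)))).measurableEmbedding

theorem reflectFst_mem_unitCube : reflectFst m i w ∈ unitCube n m ↔ w ∈ unitCube n m := by
  simp [unitCube, reflectFst, abs_reflectCoord_apply]

/-- On the cube, the symmetrized integrand is the sign times a difference of kernels. -/
theorem signAtom_mul_add_reflectFst (hw : w ∈ unitCube n m) :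
    signAtom n m i w * flagKernel n m α β ρ (z.1 - w.1) (z.2 - w.2)
      + signAtom n m i (reflectFst m i w)
        * flagKernel n m α β ρ (z.1 - (reflectFst m i w).1) (z.2 - (reflectFst m i w).2)
      = Real.sign (w.1 i) * (flagKernel n m α β ρ (z.1 - w.1) (z.2 - w.2)
        - flagKernel n m α β ρ (z.1 - reflectCoord i w.1) (z.2 - w.2)) := by
  rw [signAtom, indicator_of_mem hw, indicator_of_mem (reflectFst_mem_unitCube.2 hw)]
  simp only [reflectFst, reflectCoord_apply, if_true, Real.sign_neg]
  ring

theorem signAtom_mul_add_reflectFst_nonneg (hα : α ≤ n) (hβ : β ≤ m) (hρ : 0 ≤ ρ)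
    (hz : z.1 ∈ shiftedCube n) (hw : w ∈ unitCube n m) :
    0 ≤ signAtom n m i w * flagKernel n m α β ρ (z.1 - w.1) (z.2 - w.2)
      + signAtom n m i (reflectFst m i w)
        * flagKernel n m α β ρ (z.1 - (reflectFst m i w).1) (z.2 - (reflectFst m i w).2) := by
  rw [signAtom_mul_add_reflectFst hw]
  have hzi : 0 ≤ z.1 i := zero_le_two.trans (hz i).1
  have h1 := one_le_norm_sub i hz hw
  have h2 : 1 ≤ ‖z.1 - reflectCoord i w.1‖ :=
    one_le_norm_sub (w := reflectFst m i w) i hz (reflectFst_mem_unitCube.2 hw)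
  rcases lt_trichotomy (w.1 i) 0 with h | h | h
  · have := flagKernel_le_flagKernel hα hβ hρ (z.2 - w.2) (zero_lt_one.trans_le h2)
      (norm_sub_reflectCoord_le_norm_sub hzi h.le)
    rw [Real.sign_of_neg h]
    linarith
  · simp [h]
  · have := flagKernel_le_flagKernel hα hβ hρ (z.2 - w.2) (zero_lt_one.trans_le h1)
      (norm_sub_le_norm_sub_reflectCoord hzi h.le)
    rw [Real.sign_of_pos h]
    linarith

/-- Above the box `U`, the image of the atom decays no faster than `|y|^(β-m)`. -/
theorem exists_pos_le_flagOp_signAtom (i : Fin n) (hα : α < n) (hβ : β ≤ m) (hρ : 0 ≤ ρ) :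
    ∃ c > 0, ∀ z : EuclideanSpace ℝ (Fin n) × EuclideanSpace ℝ (Fin m), z.1 ∈ shiftedCube n →
      c * (((5 * n : ℝ) ^ ρ + m) + ‖z.2‖) ^ (β - m) ≤ flagOp n m α β ρ (signAtom n m i) z := by
  have hn : (0 : ℝ) < n := by exact_mod_cast i.pos
  obtain ⟨c, hc, hcR⟩ := exists_pos_le_rpow_sub_rpow (a := α - n) (C := 5 * n)
    (by linarith) (by positivity)
  let E : Set (EuclideanSpace ℝ (Fin n) × EuclideanSpace ℝ (Fin m)) :=
    unitCube n m ∩ {w | 1 / 2 ≤ w.1 i}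
  have hE : MeasurableSet E :=
    (measurableSet_unitCube n m).inter (measurableSet_le (by fun_prop) (by fun_prop))
  have hEtop : volume E ≠ ⊤ :=
    ((measure_mono inter_subset_left).trans_lt (volume_unitCube_lt_top n m)).ne
  have hEpos : 0 < volume.real E := ENNReal.toReal_pos (measure_unitCube_inter_pos i).ne' hEtop
  refine ⟨c * volume.real E / 2, by positivity, fun z hz => ?_⟩
  set D := (((5 * n : ℝ) ^ ρ + m) + ‖z.2‖) ^ (β - m)
  let F := fun w => signAtom n m i w * flagKernel n m α β ρ (z.1 - w.1) (z.2 - w.2)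
  have hF : Integrable F := integrable_signAtom_mul_flagKernel hα.le hβ hρ hz
  have hFσ : Integrable fun w => F (reflectFst m i w) :=
    ((measurePreserving_reflectFst i).integrable_comp_emb (measurableEmbedding_reflectFst i)).2 hF
  have hsum : 2 * flagOp n m α β ρ (signAtom n m i) z = ∫ w, (F w + F (reflectFst m i w)) := by
    rw [integral_add hF hFσ, (measurePreserving_reflectFst i).integral_comp
      (measurableEmbedding_reflectFst i), two_mul]
    rfl
  have hle : ∫ w, E.indicator (fun _ => c * D) w ≤ ∫ w, (F w + F (reflectFst m i w)) := by
    refine integral_mono ((integrable_indicator_iff hE).2 (integrableOn_const hEtop))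
      (hF.add hFσ) fun w => ?_
    by_cases hw : w ∈ unitCube n m
    · by_cases hwE : w ∈ E
      · have hwi : 1 / 2 ≤ w.1 i := hwE.2
        have hsq := norm_sub_reflectCoord_sq i z.1 w.1
        have hzi := (hz i).1
        have h1 := one_le_norm_sub i hz hw
        have hσ : reflectFst m i w ∈ unitCube n m := reflectFst_mem_unitCube.2 hw
        have h2 : 1 ≤ ‖z.1 - reflectCoord i w.1‖ := one_le_norm_sub (w := reflectFst m i w) i hz hσ
        have h3 : ‖z.1 - reflectCoord i w.1‖ ≤ 5 * n :=
          norm_sub_le_of_mem (w := reflectFst m i w) hz hσ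
        have hdiff := mul_le_flagKernel_sub (α := α) hβ hρ (z.2 - w.2) (zero_lt_one.trans_le h1)
          (norm_sub_le_norm_sub_reflectCoord (i := i) (by linarith) (by linarith))
        have hy : ‖z.2 - w.2‖ ≤ m + ‖z.2‖ := by
          have := norm_sub_le z.2 w.2
          have := EuclideanSpace.norm_le_mul_card zero_le_one hw.2
          linarith
        have hDle : D ≤ (‖z.1 - reflectCoord i w.1‖ ^ ρ + ‖z.2 - w.2‖) ^ (β - m) := by
          refine Real.rpow_le_rpow_of_nonpos (by positivity) ?_ (by linarith)
          rw [add_assoc]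
          gcongr
        rw [indicator_of_mem hwE]
        refine le_trans ?_ (signAtom_mul_add_reflectFst hw).ge
        rw [Real.sign_of_pos (by linarith), one_mul]
        refine le_trans ?_ hdiff
        have := hcR _ _ (by linarith : 0 < ‖z.1 - w.1‖) (by linarith) h3 (by nlinarith)
        exact mul_le_mul this hDle (by positivity) (by linarith)
      · rw [indicator_of_notMem hwE]
        exact signAtom_mul_add_reflectFst_nonneg hα.le hβ hρ hz hw
    · have hσ : reflectFst m i w ∉ unitCube n m := fun h => hw (reflectFst_mem_unitCube.1 h)
      have hwE : w ∉ E := fun h => hw h.1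
      simp [F, signAtom, hw, hσ, hwE]
  rw [integral_indicator_const _ hE, smul_eq_mul, ← hsum] at hle
  linarith

end signAtom

/-- The counterexample: if `α/n = β/m` and `(α+ρβ)/(n+ρm) = 1 - 1/q`, then for the
atom `a = sgn(x₁) χ_{Q_o}` one has `∬_{U×ℝ^m} |I a|^q = ∞`. -/
theorem flagOp_atom_counterexample (n m : ℕ) (hn : 0 < n) (hm : 0 < m) (α β ρ q : ℝ)
    (hα : 0 < α) (hαn : α < n) (hβ : 0 < β) (hβm : β < m) (hρ : 1 ≤ ρ)
    (hq : 1 < q)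
    (hmain : α / n = β / m)
    (hhom : (α + ρ * β) / (n + ρ * m) = 1 - 1 / q) :
    ∫⁻ w in {w : EuclideanSpace ℝ (Fin n) × EuclideanSpace ℝ (Fin m) |
        ∀ i, 2 ≤ w.1 i ∧ w.1 i ≤ 4},
      ENNReal.ofReal
        (|flagOp n m α β ρ
            (Set.indicator
              {w : EuclideanSpace ℝ (Fin n) × EuclideanSpace ℝ (Fin m) |
                (∀ i, |w.1 i| ≤ 1) ∧ (∀ j, |w.2 j| ≤ 1)}
              (fun w => Real.sign (w.1 ⟨0, hn⟩))) w| ^ q) = ⊤ := by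
  have hn' : (0 : ℝ) < n := by exact_mod_cast hn
  have hm' : (0 : ℝ) < m := by exact_mod_cast hm
  have hexp : (β - m) * q = -m := by
    have h1 : α = n * (β / m) := by rw [← hmain]; field_simp
    have h2 : (α + ρ * β) / (n + ρ * m) = β / m := by
      have : 0 < n + ρ * m := by positivity
      rw [h1]
      field_simp
    rw [h2] at hhom
    field_simp at hhom
    linarith
  obtain ⟨c, hc, hle⟩ := exists_pos_le_flagOp_signAtom (m := m) (α := α) (β := β) (ρ := ρ)
    ⟨0, hn⟩ hαn hβm.le (by linarith)
  set K : ℝ := (5 * n : ℝ) ^ ρ + m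
  have hK0 : 0 < K := by positivity
  have hset : {w : EuclideanSpace ℝ (Fin n) × EuclideanSpace ℝ (Fin m) |
      ∀ i, 2 ≤ w.1 i ∧ w.1 i ≤ 4} = shiftedCube n ×ˢ univ := by
    ext w
    simp [shiftedCube]
  rw [hset, eq_top_iff]
  calc (⊤ : ENNReal)
      = ∫⁻ w in shiftedCube n ×ˢ (univ : Set (EuclideanSpace ℝ (Fin m))),
          ENNReal.ofReal (c ^ q) * ENNReal.ofReal ((K + ‖w.2‖) ^ (-(m : ℝ))) := by
        rw [Measure.volume_eq_prod, ← Measure.prod_restrict,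
          lintegral_prod_mul (f := fun _ => ENNReal.ofReal (c ^ q))
            (g := fun y => ENNReal.ofReal ((K + ‖y‖) ^ (-(m : ℝ)))) (by fun_prop) (by fun_prop),
          Measure.restrict_univ, lintegral_const_add_norm_rpow_eq_top hm hK0,
          ENNReal.mul_top]
        have hcq : 0 < c ^ q := by positivity
        simp [hcq, (measure_shiftedCube_pos n).ne']
    _ ≤ _ := by
        refine setLIntegral_mono' ((measurableSet_shiftedCube n).prod .univ) fun w hw => ?_
        rw [← ENNReal.ofReal_mul (by positivity), ← hexp, Real.rpow_mul (by positivity),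
          ← Real.mul_rpow hc.le (by positivity)]
        refine ENNReal.ofReal_le_ofReal (Real.rpow_le_rpow (by positivity) ?_ (by linarith))
        exact (hle w hw.1).trans (le_abs_self _)
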